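/- Let g be a finite-dimensional real Lie algebra and k ⊆ g a Lie subalgebra. If p and p' are two linear subspaces with g = k ⊕ p and g = k ⊕ p' as vector spaces, then the Lie algebras (g, [·,·]₀^{k,p}) and (g, [·,·]₀^{k,p'}) are isomorphic. -/

import Mathlib

open Submodule

variable {g : Type*} [LieRing g] [LieAlgebra ℝ g]

/-- The contracted (Inönü–Wigner) bracket `[·,·]₀^{k,p}` associated to a decomposition
`g = k ⊕ p`, where `prK` is the projection onto `k` along `p` and `prP` the projection
onto `p` along `k`:
`[X,Y]₀ = [prK X, prK Y] + prP [prK X, prP Y] + prP [prP X, prK Y]`. -/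
noncomputable def contractedBracket (k p : Submodule ℝ g) (h : IsCompl k p)
    (X Y : g) : g :=
  let prK : g →ₗ[ℝ] g := k.subtype ∘ₗ (Submodule.linearProjOfIsCompl k p h)
  let prP : g →ₗ[ℝ] g := p.subtype ∘ₗ (Submodule.linearProjOfIsCompl p k h.symm)
  ⁅prK X, prK Y⁆ + prP ⁅prK X, prP Y⁆ + prP ⁅prP X, prK Y⁆

/-- If `A` and `A'` are two linear projections with the same range, then `A + (1 - A')` is
invertible, with inverse `A' + (1 - A)`. -/
def projectionChangeEquiv {R M : Type*} [Ring R] [AddCommGroup M] [Module R M] (A A' : M →ₗ[R] M)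
    (hA : ∀ x, A (A' x) = A' x) (hA' : ∀ x, A' (A x) = A x) : M ≃ₗ[R] M :=
  have h x : A (A x) = A x := by rw [← hA' x, hA]
  have h' x : A' (A' x) = A' x := by rw [← hA x, hA']
  LinearEquiv.ofLinearMap (A + (LinearMap.id - A')) (A' + (LinearMap.id - A))
    (by ext x; simp [hA, hA', h, h'])
    (by ext x; simp [hA, hA', h, h'])

/-- The contracted bracket in terms of the projection onto `k` along `p` only. -/
theorem contractedBracket_eq_projection {L : Type*} [LieRing L] [LieAlgebra ℝ L]
    (k p : Submodule ℝ L) (h : IsCompl k p) (X Y : L) :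
    contractedBracket k p h X Y =
      ⁅k.projection p h X, k.projection p h Y⁆
        + (⁅k.projection p h X, Y - k.projection p h Y⁆
          - k.projection p h ⁅k.projection p h X, Y - k.projection p h Y⁆)
        + (⁅X - k.projection p h X, k.projection p h Y⁆
          - k.projection p h ⁅X - k.projection p h X, k.projection p h Y⁆) := by
  have hP (x : L) : p.projection k h.symm x = x - k.projection p h x :=
    eq_sub_of_add_eq' (Submodule.projection_add_projection_eq_self h x)
  change ⁅k.projection p h X, k.projection p h Y⁆
    + p.projection k h.symm ⁅k.projection p h X, p.projection k h.symm Y⁆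
    + p.projection k h.symm ⁅p.projection k h.symm X, k.projection p h Y⁆ = _
  simp only [hP]

/-- Let `g` be a finite-dimensional real Lie algebra and `k ⊆ g` a Lie
subalgebra.  If `p` and `p'` are two linear complements of `k` in `g`, then the Lie
algebras `(g, [·,·]₀^{k,p})` and `(g, [·,·]₀^{k,p'})` are isomorphic. -/
theorem contraction_independent_of_complement
    (g : Type*) [LieRing g] [LieAlgebra ℝ g] [FiniteDimensional ℝ g]
    (k : LieSubalgebra ℝ g) (p p' : Submodule ℝ g)
    (h : IsCompl k.toSubmodule p) (h' : IsCompl k.toSubmodule p') :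
    ∃ e : g ≃ₗ[ℝ] g, ∀ X Y : g,
      e (contractedBracket k.toSubmodule p h X Y)
        = contractedBracket k.toSubmodule p' h' (e X) (e Y) := by
  set A : g →ₗ[ℝ] g := k.toSubmodule.projection p h with hAdef
  set A' : g →ₗ[ℝ] g := k.toSubmodule.projection p' h' with hAdef'
  have mem x : A x ∈ k := Submodule.projection_apply_mem h x
  have mem' x : A' x ∈ k := Submodule.projection_apply_mem h' x
  have fix x (hx : x ∈ k) : A x = x := Submodule.projection_apply_left h ⟨x, hx⟩
  have fix' x (hx : x ∈ k) : A' x = x := Submodule.projection_apply_left h' ⟨x, hx⟩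
  have hA x : A (A' x) = A' x := fix _ (mem' x)
  have hA' x : A' (A x) = A x := fix' _ (mem x)
  refine ⟨projectionChangeEquiv A A' hA hA', fun X Y => ?_⟩
  have he x : projectionChangeEquiv A A' hA hA' x = A x + (x - A' x) := rfl
  have hAA x : A (A x) = A x := fix _ (mem x)
  have hAA' x : A' (A' x) = A' x := fix' _ (mem' x)
  have brk x y (hx : x ∈ k) (hy : y ∈ k) : A ⁅x, y⁆ = ⁅x, y⁆ := fix _ (k.lie_mem hx hy)
  have brk' x y (hx : x ∈ k) (hy : y ∈ k) : A' ⁅x, y⁆ = ⁅x, y⁆ := fix' _ (k.lie_mem hx hy)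
  simp only [contractedBracket_eq_projection, ← hAdef, ← hAdef', he, map_add, map_sub, lie_add,
    add_lie, lie_sub, sub_lie, hA', hAA, hAA', brk _ _ (mem X) (mem Y),
    brk' _ _ (mem X) (mem Y), brk' _ _ (mem X) (mem' Y), brk' _ _ (mem' X) (mem Y)]
  abel
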